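/- Let q ≥ 4 and let M be the q×q adjacency matrix of the cycle graph C_q (entries M_{ij} = 1 if |i−j| ≡ 1 mod q, else 0). Then there exists a nonzero diagonal matrix D over ℂ such that M and M+D have the same characteristic polynomial. -/

import Mathlib

open Matrix

/-- The adjacency matrix of the cycle graph `C_q`: entry `(i,j)` is `1` iff
`i − j ≡ ±1 (mod q)`. -/
def cycleAdjMatrix (q : ℕ) : Matrix (Fin q) (Fin q) ℂ :=
  Matrix.of fun i j =>
    if ((i : ℕ) + 1) % q = (j : ℕ) ∨ ((j : ℕ) + 1) % q = (i : ℕ) then (1 : ℂ) else 0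

section Isospectral

open Polynomial

variable {n : Type*} [Fintype n] [DecidableEq n]

/-- The matrix `r M + diag(y)` over a commutative `ℂ`-algebra. -/
def diagPerturb {A : Type*} [CommRing A] [Algebra ℂ A] (M : Matrix n n ℂ) (r : A) (y : n → A) :
    Matrix n n A :=
  r • M.map (algebraMap ℂ A) + diagonal y

/-- `r M + diag(y)` has the same characteristic polynomial as `r M + s diag(w)`. -/
def IsIsospectral {A : Type*} [CommRing A] [Algebra ℂ A] (M : Matrix n n ℂ) (w : n → ℂ)
    (r s : A) (y : n → A) : Prop :=
  (diagPerturb M r y).charpoly = (diagPerturb M r fun i => s * algebraMap ℂ A (w i)).charpoly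

variable {A B : Type*} [CommRing A] [Algebra ℂ A] [CommRing B] [Algebra ℂ B]
  {M : Matrix n n ℂ} {w : n → ℂ}

lemma diagPerturb_map {n : Type*} [DecidableEq n] {M : Matrix n n ℂ}
    (f : A →ₐ[ℂ] B) (r : A) (y : n → A) :
    (diagPerturb M r y).map f = diagPerturb M (f r) (fun i => f (y i)) := by
  ext i j
  by_cases h : i = j
  · subst h; simp [diagPerturb]
  · simp [diagPerturb, h]

lemma charpoly_diagPerturb_map (f : A →ₐ[ℂ] B) (r : A) (y : n → A) :
    (diagPerturb M r y).charpoly.map (f : A →+* B) =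
      (diagPerturb M (f r) (fun i => f (y i))).charpoly := by
  rw [← charpoly_map, ← diagPerturb_map]; rfl

lemma IsIsospectral.map {r s : A} {y : n → A} (h : IsIsospectral M w r s y) (f : A →ₐ[ℂ] B) :
    IsIsospectral M w (f r) (f s) (fun i => f (y i)) := by
  have := congrArg (Polynomial.map (f : A →+* B)) h
  simpa only [IsIsospectral, charpoly_diagPerturb_map, map_mul, AlgHom.commutes] using this

lemma IsIsospectral.of_map {r s : A} {y : n → A} (f : A →ₐ[ℂ] B) (hf : Function.Injective f)
    (h : IsIsospectral M w (f r) (f s) (fun i => f (y i))) : IsIsospectral M w r s y := by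
  apply Polynomial.map_injective (f : A →+* B) hf
  simpa only [IsIsospectral, charpoly_diagPerturb_map, map_mul, AlgHom.commutes] using h

lemma Matrix.charpoly_smul_congr {K : Type*} [Field K] [Infinite K] {P Q : Matrix n n K}
    (h : P.charpoly = Q.charpoly) (c : K) : (c • P).charpoly = (c • Q).charpoly := by
  rcases eq_or_ne c 0 with rfl | hc
  · simp
  have key (P : Matrix n n K) (t : K) :
      (c • P).charpoly.eval t = c ^ Fintype.card n * P.charpoly.eval (c⁻¹ * t) := by
    rw [eval_charpoly, eval_charpoly, ← det_smul]
    congr 1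
    ext i j
    by_cases hij : i = j
    · subst hij; simp; field_simp
    · simp [hij]
  refine Polynomial.funext fun t => ?_
  rw [key, key, h]

lemma IsIsospectral.smul {K : Type*} [Field K] [Algebra ℂ K] [Infinite K] {r s : K} {y : n → K}
    (h : IsIsospectral M w r s y) (c : K) :
    IsIsospectral M w (c * r) (c * s) (fun i => c * y i) := by
  have key (r : K) (y : n → K) : c • diagPerturb M r y = diagPerturb M (c * r) fun i => c * y i := by
    ext i j
    by_cases hij : i = j
    · subst hij; simp [diagPerturb]; ring
    · simp [diagPerturb, hij, mul_assoc]
  have := charpoly_smul_congr h c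
  rw [key, key] at this
  simpa only [IsIsospectral, mul_assoc] using this

lemma IsIsospectral.eq_zero {K : Type*} [Field K] [Algebra ℂ K] {y : n → K}
    (h : IsIsospectral M w 0 0 y) (j : n) : y j = 0 := by
  have := congrArg (Polynomial.eval (y j)) h
  simp only [diagPerturb, zero_smul, zero_add, zero_mul, charpoly_diagonal, eval_prod,
    eval_sub, eval_X, eval_C, Finset.prod_const] at this
  rw [Finset.prod_eq_zero (Finset.mem_univ j) (sub_self _)] at this
  rw [eval_pow] at this
  simpa using eq_zero_of_pow_eq_zero this.symm

lemma IsIsospectral.mem_valuationSubring {K : Type*} [Field K] [Algebra ℂ K] [Infinite K]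
    {r s : K} {y : n → K} (h : IsIsospectral M w r s y) (V : ValuationSubring K)
    (hV : ∀ c, algebraMap ℂ K c ∈ V) (hr : r ∈ V) (hs : s ∈ V) (i : n) : y i ∈ V := by
  have : Nonempty n := ⟨i⟩
  obtain ⟨j, hj⟩ := Finite.exists_max fun i => V.valuation (y i)
  by_contra hi
  have hj1 : 1 < V.valuation (y j) := by
    rw [← V.valuation_le_one_iff, not_le] at hi
    exact hi.trans_le (hj i)
  have hj0 : y j ≠ 0 := by
    rintro h0; simp [h0] at hj1
  let : Algebra ℂ V := ((algebraMap ℂ K).codRestrict V.toSubring hV).toAlgebra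
  let f : V →ₐ[ℂ] K := { V.subtype with commutes' := fun _ => rfl }
  have hlt {x : K} (hx : x ∈ V) : V.valuation ((y j)⁻¹ * x) < 1 := by
    rw [map_mul, map_inv₀]
    calc _ ≤ (V.valuation (y j))⁻¹ * 1 := by
          gcongr; exact (V.valuation_le_one_iff x).2 hx
      _ < 1 := by rw [mul_one]; exact inv_lt_one_of_one_lt₀ hj1
  have hle (k : n) : (y j)⁻¹ * y k ∈ V := by
    rw [← V.valuation_le_one_iff, map_mul, map_inv₀]
    calc _ ≤ (V.valuation (y j))⁻¹ * V.valuation (y j) := by gcongr; exact hj k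
      _ = 1 := inv_mul_cancel₀ (zero_lt_one.trans hj1).ne'
  have h1 : IsIsospectral M w (A := V) ⟨_, (V.valuation_le_one_iff _).1 (hlt hr).le⟩
      ⟨_, (V.valuation_le_one_iff _).1 (hlt hs).le⟩ (fun k => ⟨_, hle k⟩) :=
    IsIsospectral.of_map f Subtype.val_injective (h.smul (y j)⁻¹)
  have h2 := h1.map (IsScalarTower.toAlgHom ℂ V (IsLocalRing.ResidueField V))
  have hz {x : K} (hx : x ∈ V) : IsScalarTower.toAlgHom ℂ V (IsLocalRing.ResidueField V)
      ⟨_, (V.valuation_le_one_iff _).1 (hlt hx).le⟩ = 0 := by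
    refine (IsLocalRing.residue_eq_zero_iff _).2 ?_
    exact (V.valuation_lt_one_iff _).2 (hlt hx)
  rw [hz hr, hz hs] at h2
  have h3 := h2.eq_zero j
  simp [hj0] at h3
  have : (⟨1, V.one_mem⟩ : V) = 1 := rfl
  simp [this] at h3

lemma IsIsospectral.isIntegral {R K : Type*} [CommRing R] [Field K] [Algebra ℂ R] [Algebra ℂ K]
    [Algebra R K] [IsScalarTower ℂ R K] [Infinite K] {r s : R} {y : n → K}
    (h : IsIsospectral M w (algebraMap R K r) (algebraMap R K s) y) (i : n) :
    IsIntegral R (y i) := by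
  by_contra hi
  have hi' : y i ∉ (integralClosure R K).toSubring := hi
  obtain ⟨V, hV, hiV⟩ := Subring.exists_le_valuationSubring_of_isIntegrallyClosedIn hi'
  have hRV (x : R) : algebraMap R K x ∈ V := hV (isIntegral_algebraMap (R := R) (x := x))
  refine hiV (h.mem_valuationSubring V (fun c => ?_) (hRV r) (hRV s) i)
  rw [IsScalarTower.algebraMap_apply ℂ R K]
  exact hRV _

end Isospectral

lemma exists_algHom_integralClosure {R K : Type*} [CommRing R] [Field K] [Algebra ℂ R]
    [Algebra ℂ K] [Algebra R K] [IsScalarTower ℂ R K] [FaithfulSMul R K] (φ : R →ₐ[ℂ] ℂ) :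
    ∃ ψ : integralClosure R K →ₐ[ℂ] ℂ, ∀ r, ψ (algebraMap R _ r) = φ r := by
  have hinj : Function.Injective (algebraMap R (integralClosure R K)) :=
    fun _ _ h => FaithfulSMul.algebraMap_injective R K (congrArg Subtype.val h)
  have hP : (RingHom.ker φ).IsPrime := RingHom.ker_isPrime _
  obtain ⟨Q, -, hQ, hQP⟩ := Ideal.exists_ideal_over_prime_of_isIntegral (RingHom.ker φ)
    (⊥ : Ideal (integralClosure R K)) (by
      intro x hx
      rw [Ideal.mem_comap, Ideal.mem_bot] at hx
      rw [hinj (hx.trans (map_zero _).symm)]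
      exact zero_mem _)
  let S := integralClosure R K ⧸ Q
  have hφ (r : R) : Ideal.Quotient.mk Q (algebraMap R _ r) = algebraMap ℂ S (φ r) := by
    have : r - algebraMap ℂ R (φ r) ∈ RingHom.ker φ := by simp [RingHom.mem_ker]
    rw [← hQP, Ideal.mem_comap, map_sub, ← IsScalarTower.algebraMap_apply,
      ← Ideal.Quotient.eq] at this
    exact this
  have hint : Algebra.IsIntegral ℂ S := by
    refine ⟨fun x => ?_⟩
    obtain ⟨x, rfl⟩ := Ideal.Quotient.mk_surjective x
    obtain ⟨p, hp, hpx⟩ := Algebra.IsIntegral.isIntegral (R := R) x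
    refine ⟨p.map (φ : R →+* ℂ), hp.map _, ?_⟩
    rw [Polynomial.eval₂_map]
    have hc : (algebraMap ℂ S).comp (φ : R →+* ℂ) = (Ideal.Quotient.mk Q).comp (algebraMap R _) :=
      RingHom.ext fun r => (hφ r).symm
    rw [hc, ← Polynomial.hom_eval₂, hpx, map_zero]
  let e : ℂ ≃ₐ[ℂ] S := AlgEquiv.ofBijective (Algebra.ofId ℂ S)
    IsAlgClosed.algebraMap_bijective_of_isIntegral
  refine ⟨(e.symm : S →ₐ[ℂ] ℂ).comp (Ideal.Quotient.mkₐ ℂ Q), fun r => ?_⟩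
  change e.symm (Ideal.Quotient.mk Q (algebraMap R _ r)) = _
  rw [AlgEquiv.symm_apply_eq, hφ]
  rfl

lemma mem_range_algebraMap_of_forall_algHom {R K : Type*} [CommRing R] [IsDomain R] [CharZero R]
    [IsIntegrallyClosed R] [Field K] [IsAlgClosed K] [Algebra R K] [FaithfulSMul R K]
    (z : integralClosure R K)
    (hz : ∀ τ : integralClosure R K →ₐ[R] K, Function.Injective τ → τ z = z) :
    ∃ x, algebraMap R K x = z := by
  let _ : Algebra (FractionRing R) K := FractionRing.liftAlgebra R K
  have _ : IsScalarTower R (FractionRing R) K := FractionRing.isScalarTower_liftAlgebra R K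
  let k := FractionRing R
  let E := algebraicClosure k K
  have hE (y : integralClosure R K) : (y : K) ∈ E := by
    have : IsIntegral R (y : K) := y.2
    exact this.tower_top
  have : IsAlgClosed E := (inferInstance : IsAlgClosure k E).isAlgClosed
  have : Normal k E := IsAlgClosure.normal k E
  have : CharZero k := charZero_of_injective_algebraMap (FaithfulSMul.algebraMap_injective R k)
  have : IsGalois k E := ⟨⟩
  let ι : integralClosure R K →ₐ[R] E :=
    (integralClosure R K).val.codRestrict ((algebraicClosure k K).toSubalgebra.restrictScalars R) hE
  have hfix (σ : E ≃ₐ[k] E) : σ (ι z) = ι z := by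
    apply Subtype.ext
    exact hz ((AlgHom.restrictScalars R E.val).comp
      ((AlgHom.restrictScalars R (σ : E →ₐ[k] E)).comp ι))
      (Subtype.val_injective.comp (σ.injective.comp fun _ _ h =>
        Subtype.ext (congrArg (fun x : E => (x : K)) h)))
  obtain ⟨x, hx⟩ := (InfiniteGalois.mem_range_algebraMap_iff_fixed (k := k) (K := E) (ι z)).2 hfix
  have hxz : algebraMap k K x = z := congrArg Subtype.val hx
  have hint : IsIntegral R x := by
    have h1 : IsIntegral R (algebraMap k K x) := hxz ▸ z.2
    exact (isIntegral_algebraMap_iff (algebraMap k K).injective).1 h1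
  obtain ⟨r, rfl⟩ := IsIntegrallyClosed.isIntegral_iff.1 hint
  exact ⟨r, by rw [← hxz, ← IsScalarTower.algebraMap_apply]⟩

section Lifting

variable {n : Type*} [Fintype n] [DecidableEq n] {R A : Type*} [CommRing R] [CommRing A]
  [Algebra R A] {φ : R →+* ℂ} {ρ : A →+* ℂ}

lemma MvPolynomial.exists_aeval_sub_aeval (hρ : ρ.comp (algebraMap R A) = φ) {y z : n → A}
    {a : n → ℂ} (hy : ∀ i, ρ (y i) = a i) (hz : ∀ i, ρ (z i) = a i) (p : MvPolynomial n R) :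
    ∃ c : n → A, aeval y p - aeval z p = ∑ j, c j * (y j - z j) ∧
      ∀ j, ρ (c j) = eval₂ φ a (pderiv j p) := by
  have hev (p : MvPolynomial n R) {y : n → A} (hy : ∀ i, ρ (y i) = a i) :
      ρ (aeval y p) = eval₂ φ a p := by
    rw [aeval_def, ← coe_eval₂Hom, MvPolynomial.map_eval₂Hom, hρ, coe_eval₂Hom]
    simp only [hy]
  induction p using MvPolynomial.induction_on with
  | C r => exact ⟨0, by simp, by simp⟩
  | add p q hp hq =>
    obtain ⟨c, hc, hc'⟩ := hp
    obtain ⟨d, hd, hd'⟩ := hq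
    refine ⟨c + d, ?_, fun j => by simp [hc', hd', eval₂_add]⟩
    simp only [map_add, Pi.add_apply, add_mul, Finset.sum_add_distrib, ← hc, ← hd]
    ring
  | mul_X p i hp =>
    obtain ⟨c, hc, hc'⟩ := hp
    refine ⟨fun j => c j * y i + (if i = j then aeval z p else 0), ?_, fun j => ?_⟩
    · have h1 : ∑ j, (c j * y i + (if i = j then aeval z p else 0)) * (y j - z j) =
          (∑ j, c j * (y j - z j)) * y i + aeval z p * (y i - z i) := by
        simp only [add_mul, Finset.sum_add_distrib, Finset.sum_mul]
        congr 1
        · exact Finset.sum_congr rfl fun j _ => by ring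
        · rw [Finset.sum_eq_single i]
          · simp
          · intro j _ hj; simp [hj.symm]
          · simp
      rw [h1, ← hc]
      simp only [map_mul, aeval_X]
      ring
    · rw [Derivation.leibniz, pderiv_X]
      by_cases h : i = j
      · subst h
        simp only [map_add, map_mul, hc', hy, if_true, Pi.single_eq_same, hev p hz, smul_eq_mul,
          eval₂_add, eval₂_mul, eval₂_X, eval₂_one]
        ring
      · simp [h, hc', hy, eval₂_mul, mul_comm]

variable {P : n → MvPolynomial n R} {a u : n → ℂ}

lemma MvPolynomial.eq_of_aeval_eq_zero [IsDomain A] (hρ : ρ.comp (algebraMap R A) = φ)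
    (hu : ∀ i, u i ≠ 0)
    (hJ : ∀ i j, eval₂ φ a (pderiv j (P i)) = if i = j then u i else 0) {y z : n → A}
    (hy : ∀ i, ρ (y i) = a i) (hz : ∀ i, ρ (z i) = a i) (hPy : ∀ i, aeval y (P i) = 0)
    (hPz : ∀ i, aeval z (P i) = 0) : y = z := by
  choose c hc hc' using fun i => exists_aeval_sub_aeval hρ hy hz (P i)
  have hdet : (Matrix.of c).det ≠ 0 := by
    intro h
    have h1 : (Matrix.of c).map ρ = diagonal u := by
      ext i j
      simp [hc', hJ, diagonal_apply]
    have h2 := congrArg ρ h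
    rw [RingHom.map_det, RingHom.mapMatrix_apply, h1, det_diagonal, map_zero] at h2
    exact Finset.prod_ne_zero_iff.2 (fun i _ => hu i) h2
  refine sub_eq_zero.1 (eq_zero_of_mulVec_eq_zero hdet ?_)
  ext i
  have := hc i
  rw [hPy, hPz, sub_zero] at this
  simpa [mulVec, dotProduct] using this.symm

open scoped PowerSeries in
lemma MvPolynomial.exists_powerSeries_aeval_eq_zero {P : n → MvPolynomial n ℂ⟦X⟧}
    (hu : ∀ i, u i ≠ 0) (h0 : ∀ i, eval₂ (PowerSeries.constantCoeff (R := ℂ)) a (P i) = 0)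
    (hJ : ∀ i j, eval₂ (PowerSeries.constantCoeff (R := ℂ)) a (pderiv j (P i)) =
      if i = j then u i else 0) :
    ∃ y : n → ℂ⟦X⟧, (∀ i, PowerSeries.constantCoeff (y i) = a i) ∧ ∀ i, aeval y (P i) = 0 := by
  let Y : ℕ → n → ℂ⟦X⟧ := fun m => Nat.rec (fun i => PowerSeries.C (a i))
    (fun _ z i => z i - PowerSeries.C (u i)⁻¹ * aeval z (P i)) m
  have hY (m : ℕ) (i : n) :
      Y (m + 1) i = Y m i - PowerSeries.C (u i)⁻¹ * aeval (Y m) (P i) := rfl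
  have hid : (PowerSeries.constantCoeff (R := ℂ)).comp (algebraMap ℂ⟦X⟧ ℂ⟦X⟧) =
      PowerSeries.constantCoeff := rfl
  have key (m : ℕ) : (∀ i, PowerSeries.constantCoeff (Y m i) = a i) ∧
      ∀ i, (PowerSeries.X : ℂ⟦X⟧) ^ (m + 1) ∣ aeval (Y m) (P i) := by
    induction m with
    | zero =>
      refine ⟨fun i => by simp [Y], fun i => ?_⟩
      rw [zero_add, pow_one, PowerSeries.X_dvd_iff, aeval_def, ← coe_eval₂Hom,
        MvPolynomial.map_eval₂Hom, hid]
      simpa [Y] using h0 i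
    | succ m ih =>
      obtain ⟨ih1, ih2⟩ := ih
      have h1 (i : n) : PowerSeries.constantCoeff (Y (m + 1) i) = a i := by
        have h := (dvd_pow_self (PowerSeries.X : ℂ⟦X⟧) m.succ_ne_zero).trans (ih2 i)
        rw [PowerSeries.X_dvd_iff] at h
        rw [hY, map_sub, ih1, map_mul, h, mul_zero, sub_zero]
      refine ⟨h1, fun i => ?_⟩
      obtain ⟨c, hc, hc'⟩ := exists_aeval_sub_aeval hid h1 ih1 (P i)
      have h2 : aeval (Y (m + 1)) (P i) =
          ∑ j, ((if i = j then 1 else 0) - c j * PowerSeries.C (u j)⁻¹) * aeval (Y m) (P j) := by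
        simp only [sub_mul, Finset.sum_sub_distrib]
        rw [eq_add_of_sub_eq hc, Finset.sum_eq_single (f := fun j =>
          (if i = j then 1 else 0) * aeval (Y m) (P j)) i (fun j _ hj => by simp [hj.symm]) (by simp)]
        simp only [hY, if_true, one_mul]
        rw [add_comm, sub_eq_add_neg, ← Finset.sum_neg_distrib]
        congr 1
        exact Finset.sum_congr rfl fun j _ => by ring
      rw [h2, pow_succ']
      refine Finset.dvd_sum fun j _ => mul_dvd_mul ?_ (ih2 j)
      rw [PowerSeries.X_dvd_iff, map_sub, map_mul, hc', hJ]
      by_cases h : i = j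
      · subst h; simp [hu]
      · simp [h]
  have hcoeff (i : n) (m d : ℕ) :
      PowerSeries.coeff m (Y (m + d) i) = PowerSeries.coeff m (Y m i) := by
    induction d with
    | zero => rfl
    | succ d ih =>
      have h := PowerSeries.X_pow_dvd_iff.1 ((key (m + d)).2 i)
      rw [← add_assoc, hY, map_sub, ih, sub_eq_self, ← PowerSeries.smul_eq_C_mul, map_smul,
        h m (by omega), smul_zero]
  let y : n → ℂ⟦X⟧ := fun i => PowerSeries.mk fun m => PowerSeries.coeff m (Y m i)
  have hy (i : n) (m : ℕ) : (PowerSeries.X : ℂ⟦X⟧) ^ (m + 1) ∣ y i - Y m i := by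
    refine PowerSeries.X_pow_dvd_iff.2 fun k hk => ?_
    obtain ⟨d, rfl⟩ := Nat.exists_eq_add_of_le (Nat.lt_succ_iff.1 hk)
    simp [y, hcoeff]
  have hy0 (i : n) : PowerSeries.constantCoeff (y i) = a i := by
    rw [← PowerSeries.coeff_zero_eq_constantCoeff_apply]
    simp [y, (key 0).1]
  refine ⟨y, hy0, fun i => ?_⟩
  ext m
  obtain ⟨c, hc, -⟩ := exists_aeval_sub_aeval hid hy0 (key m).1 (P i)
  have : (PowerSeries.X : ℂ⟦X⟧) ^ (m + 1) ∣ aeval y (P i) := by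
    rw [eq_add_of_sub_eq hc]
    exact dvd_add (Finset.dvd_sum fun j _ => (hy j m).mul_left _) ((key m).2 i)
  simpa using PowerSeries.X_pow_dvd_iff.1 this m (Nat.lt_succ_self m)

end Lifting

section Equations

variable {n : Type*} [Fintype n] [DecidableEq n] {R A : Type*} [CommRing R] [CommRing A]
  [Algebra ℂ R] [Algebra ℂ A] [Algebra R A] [IsScalarTower ℂ R A] (M : Matrix n n ℂ) (w : n → ℂ)

/-- The value at `w l` of the difference of the characteristic polynomials of `r M + diag(X)` and
`r M + diag(w)`, as a polynomial in the diagonal entries `X`. -/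
noncomputable def isospectralEquation (r : R) (l : n) : MvPolynomial n R :=
  (diagPerturb M (MvPolynomial.C r) MvPolynomial.X).charpoly.eval (algebraMap ℂ _ (w l)) -
    MvPolynomial.C ((diagPerturb M r fun i => algebraMap ℂ R (w i)).charpoly.eval
      (algebraMap ℂ R (w l)))

variable {M w}

lemma eval_charpoly_diagPerturb_map {A B : Type*} [CommRing A] [CommRing B] [Algebra ℂ A]
    [Algebra ℂ B] (f : A →ₐ[ℂ] B) (r : A) (y : n → A) (c : ℂ) :
    f ((diagPerturb M r y).charpoly.eval (algebraMap ℂ A c)) =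
      (diagPerturb M (f r) fun i => f (y i)).charpoly.eval (algebraMap ℂ B c) := by
  rw [← charpoly_diagPerturb_map, ← AlgHom.commutes f c]
  exact (Polynomial.eval_map_apply (f : A →+* B) _).symm

lemma aeval_isospectralEquation (r : R) (y : n → A) (l : n) :
    MvPolynomial.aeval y (isospectralEquation M w r l) =
      (diagPerturb M (algebraMap R A r) y).charpoly.eval (algebraMap ℂ A (w l)) -
      (diagPerturb M (algebraMap R A r) fun i => algebraMap ℂ A (w i)).charpoly.eval
        (algebraMap ℂ A (w l)) := by
  have h1 := eval_charpoly_diagPerturb_map (M := M)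
    ((MvPolynomial.aeval (R := R) y).restrictScalars ℂ)
    (MvPolynomial.C r) MvPolynomial.X (w l)
  have h2 := eval_charpoly_diagPerturb_map (M := M) (IsScalarTower.toAlgHom ℂ R A) r
    (fun i => algebraMap ℂ R (w i)) (w l)
  simp only [AlgHom.restrictScalars_apply, MvPolynomial.aeval_X, MvPolynomial.aeval_C] at h1
  simp only [IsScalarTower.coe_toAlgHom', ← IsScalarTower.algebraMap_apply] at h2
  rw [isospectralEquation, map_sub, h1, MvPolynomial.aeval_C, h2]

lemma IsIsospectral.aeval_isospectralEquation {r : R} {y : n → A}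
    (h : IsIsospectral M w (algebraMap R A r) 1 y) (l : n) :
    MvPolynomial.aeval y (isospectralEquation M w r l) = 0 := by
  rw [_root_.aeval_isospectralEquation, h]
  simp only [one_mul, sub_self]

lemma isIsospectral_of_aeval_isospectralEquation [IsDomain A] [FaithfulSMul ℂ A]
    (hw : Function.Injective w) {r : R} {y : n → A}
    (h : ∀ l, MvPolynomial.aeval y (isospectralEquation M w r l) = 0) :
    IsIsospectral M w (algebraMap R A r) 1 y := by
  simp only [IsIsospectral, one_mul]
  refine Polynomial.eq_of_degree_sub_lt_of_eval_index_eq (s := Finset.univ)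
    (v := fun l => algebraMap ℂ A (w l))
    ((FaithfulSMul.algebraMap_injective ℂ A).comp hw).injOn ?_ fun l _ => ?_
  · refine (Polynomial.degree_sub_lt_left ?_ (charpoly_monic _).ne_zero ?_).trans_eq ?_
    · rw [charpoly_degree_eq_dim, charpoly_degree_eq_dim]
    · rw [(charpoly_monic _).leadingCoeff, (charpoly_monic _).leadingCoeff]
    · rw [charpoly_degree_eq_dim, Finset.card_univ]
  · have := h l
    rwa [aeval_isospectralEquation, sub_eq_zero] at this

lemma map_isospectralEquation (φ : R →ₐ[ℂ] ℂ) {r : R} (hr : φ r = 0) (l : n) :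
    MvPolynomial.map (φ : R →+* ℂ) (isospectralEquation M w r l) =
      ∏ k, (MvPolynomial.C (w l) - MvPolynomial.X k) := by
  have h1 := eval_charpoly_diagPerturb_map (M := M) (MvPolynomial.mapAlgHom (σ := n) φ)
    (MvPolynomial.C r) MvPolynomial.X (w l)
  have h2 := eval_charpoly_diagPerturb_map (M := M) φ r (fun i => algebraMap ℂ R (w i)) (w l)
  rw [← MvPolynomial.mapAlgHom_apply, isospectralEquation, map_sub, h1]
  simp only [MvPolynomial.mapAlgHom_apply, MvPolynomial.map_C, MvPolynomial.map_X,
    RingHom.coe_coe]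
  rw [h2]
  simp [hr, diagPerturb, charpoly_diagonal, Polynomial.eval_prod,
    Finset.prod_eq_zero (Finset.mem_univ l), MvPolynomial.algebraMap_eq]

lemma eval₂_isospectralEquation (φ : R →ₐ[ℂ] ℂ) {r : R} (hr : φ r = 0) (σ : Equiv.Perm n) (l : n) :
    MvPolynomial.eval₂ (φ : R →+* ℂ) (fun i => w (σ i)) (isospectralEquation M w r l) = 0 := by
  rw [MvPolynomial.eval₂_eq_eval_map, map_isospectralEquation φ hr, map_prod]
  exact Finset.prod_eq_zero (Finset.mem_univ (σ.symm l)) (by simp)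

lemma eval₂_pderiv_isospectralEquation (φ : R →ₐ[ℂ] ℂ) {r : R} (hr : φ r = 0)
    (σ : Equiv.Perm n) (i j : n) :
    MvPolynomial.eval₂ (φ : R →+* ℂ) (fun i => w (σ i))
      (MvPolynomial.pderiv j (isospectralEquation M w r (σ i))) =
    if i = j then -∏ k ∈ Finset.univ.erase i, (w (σ i) - w (σ k)) else 0 := by
  rw [MvPolynomial.eval₂_eq_eval_map, ← MvPolynomial.pderiv_map, map_isospectralEquation φ hr,
    ← Finset.mul_prod_erase _ _ (Finset.mem_univ i), Derivation.leibniz]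
  by_cases h : i = j
  · subst h; simp
  · simp [MvPolynomial.pderiv_X_of_ne h, h]

lemma IsIsospectral.exists_perm (hw : Function.Injective w) {y : n → ℂ}
    (h : IsIsospectral M w 0 1 y) : ∃ σ : Equiv.Perm n, ∀ i, y i = w (σ i) := by
  simp only [IsIsospectral, diagPerturb, zero_smul, zero_add, one_mul, charpoly_diagonal] at h
  have key (t : ℂ) : (∃ i, t = y i) ↔ ∃ i, t = w i := by
    have := congrArg (Polynomial.eval t · = 0) h
    simpa [Polynomial.eval_prod, Finset.prod_eq_zero_iff, sub_eq_zero] using this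
  choose σ hσ using fun i => (key (y i)).1 ⟨i, rfl⟩
  have hsurj : Function.Surjective σ := fun j => by
    obtain ⟨i, hi⟩ := (key (w j)).2 ⟨j, rfl⟩
    exact ⟨i, hw (by rw [← hσ, hi])⟩
  exact ⟨Equiv.ofBijective σ
    (Finite.injective_iff_bijective.1 (Finite.injective_iff_surjective.2 hsurj)), hσ⟩

end Equations

section Branches

variable {n : Type*} [Fintype n] [DecidableEq n] {M : Matrix n n ℂ} {w : n → ℂ}

lemma IsIsospectral.eq_of_map_eq {R A : Type*} [CommRing R] [CommRing A] [IsDomain A]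
    [Algebra ℂ R] [Algebra ℂ A] [Algebra R A] [IsScalarTower ℂ R A] (hw : Function.Injective w)
    (φ : R →ₐ[ℂ] ℂ) (ρ : A →+* ℂ) (hρ : ∀ r, ρ (algebraMap R A r) = φ r) {r : R} (hr : φ r = 0)
    (σ : Equiv.Perm n) {y z : n → A} (hy : IsIsospectral M w (algebraMap R A r) 1 y)
    (hz : IsIsospectral M w (algebraMap R A r) 1 z) (hρy : ∀ i, ρ (y i) = w (σ i))
    (hρz : ∀ i, ρ (z i) = w (σ i)) : y = z :=
  MvPolynomial.eq_of_aeval_eq_zero (φ := φ) (ρ := ρ) (RingHom.ext hρ)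
    (u := fun i => -∏ k ∈ Finset.univ.erase i, (w (σ i) - w (σ k)))
    (P := fun i => isospectralEquation M w r (σ i))
    (fun _ => neg_ne_zero.2 <| Finset.prod_ne_zero_iff.2 fun _ hk => sub_ne_zero.2 fun h =>
      Finset.ne_of_mem_erase hk (σ.injective (hw h)).symm)
    (eval₂_pderiv_isospectralEquation φ hr σ) hρy hρz
    (fun i => hy.aeval_isospectralEquation (σ i)) (fun i => hz.aeval_isospectralEquation (σ i))

open scoped PowerSeries in
lemma exists_powerSeries_isIsospectral (M : Matrix n n ℂ) (hw : Function.Injective w)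
    (σ : Equiv.Perm n) : ∃ y : n → ℂ⟦X⟧, IsIsospectral M w PowerSeries.X 1 y ∧
      ∀ i, PowerSeries.constantCoeff (y i) = w (σ i) := by
  let φ : ℂ⟦X⟧ →ₐ[ℂ] ℂ := { PowerSeries.constantCoeff with commutes' := fun c => by simp }
  have hφ : φ PowerSeries.X = 0 := PowerSeries.constantCoeff_X
  obtain ⟨y, hy, hPy⟩ := MvPolynomial.exists_powerSeries_aeval_eq_zero
    (u := fun i => -∏ k ∈ Finset.univ.erase i, (w (σ i) - w (σ k)))
    (P := fun i => isospectralEquation M w PowerSeries.X (σ i))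
    (fun _ => neg_ne_zero.2 <| Finset.prod_ne_zero_iff.2 fun _ hk => sub_ne_zero.2 fun h =>
      Finset.ne_of_mem_erase hk (σ.injective (hw h)).symm)
    (fun i => eval₂_isospectralEquation φ hφ σ (σ i))
    (eval₂_pderiv_isospectralEquation φ hφ σ)
  have h : IsIsospectral M w (algebraMap ℂ⟦X⟧ ℂ⟦X⟧ PowerSeries.X) 1 y := by
    refine isIsospectral_of_aeval_isospectralEquation hw fun l => ?_
    rw [← hPy (σ.symm l), σ.apply_symm_apply]
  exact ⟨y, h, hy⟩

end Branches

section Expansion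

variable {n : Type*} [Fintype n] [DecidableEq n]

lemma Matrix.det_of_arrow {K : Type*} [Field K] {B : Matrix n n K} {i : n} (hi : B i i = 0)
    (hB : ∀ j k, j ≠ i → k ≠ i → j ≠ k → B j k = 0) (hd : ∀ j, j ≠ i → B j j ≠ 0) :
    B.det = -((∏ k ∈ Finset.univ.erase i, B k k) *
      ∑ j ∈ Finset.univ.erase i, B i j * B j i / B j j) := by
  let v : n → K := fun j => if j = i then 1 else -(B j i / B j j)
  have hv : B *ᵥ v = Pi.single i (-∑ j ∈ Finset.univ.erase i, B i j * B j i / B j j) := by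
    ext j
    rw [mulVec, dotProduct, ← Finset.add_sum_erase _ _ (Finset.mem_univ i)]
    have h1 (a : n) (ha : a ∈ Finset.univ.erase i) : B j a * v a = -(B j a * (B a i / B a a)) := by
      simp [v, Finset.ne_of_mem_erase ha]
    rw [Finset.sum_congr rfl h1, Finset.sum_neg_distrib]
    by_cases hj : j = i
    · subst hj
      simp [v, hi, mul_div_assoc]
    · rw [Pi.single_eq_of_ne hj, Finset.sum_eq_single j]
      · simp only [v, if_true, mul_one]
        field_simp [hd j hj]
        ring
      · intro a ha haj
        rw [hB j a hj (Finset.ne_of_mem_erase ha) haj.symm, zero_mul]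
      · simp [hj]
  have h1 : (B.updateCol i (B *ᵥ v)).det = B.det := by
    have := det_updateCol_sum B i v
    rw [show v i = 1 by simp [v], one_smul] at this
    rw [← this]
    congr 2
    ext j
    simp [mulVec, dotProduct, mul_comm]
  rw [← h1, hv, det_apply', Finset.sum_eq_single 1]
  · rw [← Finset.mul_prod_erase _ _ (Finset.mem_univ i)]
    simp only [Equiv.Perm.sign_one, Equiv.Perm.one_apply, updateCol_self, Pi.single_eq_same,
      Units.val_one, Int.cast_one, one_mul]
    rw [Finset.prod_congr rfl fun k hk => updateCol_ne (Finset.ne_of_mem_erase hk)]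
    ring
  · intro τ _ hτ
    suffices ∃ k, B.updateCol i
        (Pi.single i (-∑ j ∈ Finset.univ.erase i, B i j * B j i / B j j)) (τ k) k = 0 by
      obtain ⟨k, hk⟩ := this
      exact mul_eq_zero_of_right _ (Finset.prod_eq_zero (Finset.mem_univ k) hk)
    by_cases hτi : τ i = i
    · obtain ⟨k, hk⟩ : ∃ k, τ k ≠ k := by
        by_contra! h
        exact hτ (Equiv.ext h)
      have hki : k ≠ i := fun h => hk (h ▸ hτi)
      refine ⟨k, ?_⟩
      rw [updateCol_ne hki]
      exact hB _ _ (fun h => hki (τ.injective (h.trans hτi.symm))) hki hk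
    · exact ⟨i, by rw [updateCol_self, Pi.single_eq_of_ne hτi]⟩
  · simp

open scoped PowerSeries in
lemma exists_det_eq_X_mul {M : Matrix n n ℂ} {B : Matrix n n ℂ⟦X⟧} {i : n} {z : ℂ⟦X⟧}
    (hM : M i i = 0) {d : n → ℂ} (hd : ∀ j, j ≠ i → d j ≠ 0) (hi : B i i = PowerSeries.X * z)
    (hB : ∀ j k, j ≠ k → B j k = -(PowerSeries.X * PowerSeries.C (M j k)))
    (hBd : ∀ j, j ≠ i → PowerSeries.constantCoeff (B j j) = d j) :
    ∃ m t : ℂ⟦X⟧, B.det = PowerSeries.X * (z * m + PowerSeries.X * t) ∧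
      PowerSeries.constantCoeff m = ∏ k ∈ Finset.univ.erase i, d k ∧
      PowerSeries.constantCoeff t = -((∏ k ∈ Finset.univ.erase i, d k) *
        ∑ j, M i j * M j i / d j) := by
  let ρ : n → ℂ⟦X⟧ := fun j => -PowerSeries.C (M i j)
  let κ : n → ℂ⟦X⟧ := fun j => -PowerSeries.C (M j i)
  have h1 : B = B.updateRow i ((PowerSeries.X : ℂ⟦X⟧) • (z • Pi.single i 1 + ρ)) := by
    ext1 j k
    by_cases hj : j = i
    · subst hj
      by_cases hk : k = j
      · subst hk; simp [hi, ρ, hM]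
      · simp [hB _ _ (Ne.symm hk), hk, ρ]
    · simp [hj]
  have h2 : B.updateRow i ρ =
      (B.updateRow i ρ).updateCol i ((PowerSeries.X : ℂ⟦X⟧) • κ) := by
    ext1 j k
    by_cases hk : k = i
    · subst hk
      by_cases hj : j = k
      · subst hj; simp [ρ, κ, hM]
      · simp [hB _ _ hj, hj, κ]
    · simp [hk]
  refine ⟨(B.updateRow i (Pi.single i 1)).det, ((B.updateRow i ρ).updateCol i κ).det, ?_, ?_, ?_⟩
  · conv_lhs => rw [h1, det_updateRow_smul, det_updateRow_add, det_updateRow_smul, h2,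
      det_updateCol_smul]
  · have h3 : (B.updateRow i (Pi.single i 1)).map (PowerSeries.constantCoeff (R := ℂ)) =
        diagonal (Function.update d i 1) := by
      ext j k
      by_cases hj : j = i
      · subst hj
        by_cases hk : k = j
        · subst hk; simp
        · simp [hk, Ne.symm hk]
      · by_cases hk : j = k
        · subst hk; simp [hj, hBd]
        · simp [hj, hk, hB]
    rw [RingHom.map_det, RingHom.mapMatrix_apply, h3, det_diagonal,
      ← Finset.mul_prod_erase _ _ (Finset.mem_univ i), Function.update_self, one_mul]
    exact Finset.prod_congr rfl fun k hk => Function.update_of_ne (Finset.ne_of_mem_erase hk) _ _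
  · have h4 (k : n) (hk : k ≠ i) : (((B.updateRow i ρ).updateCol i κ).map
        (PowerSeries.constantCoeff (R := ℂ))) k k = d k := by simp [hk, hBd]
    rw [RingHom.map_det, RingHom.mapMatrix_apply, det_of_arrow (i := i)]
    · rw [Finset.prod_congr rfl fun k hk => h4 k (Finset.ne_of_mem_erase hk),
        ← Finset.add_sum_erase _ (fun j => M i j * M j i / d j) (Finset.mem_univ i), hM]
      rw [zero_mul, zero_div, zero_add]
      refine congrArg _ (congrArg _ (Finset.sum_congr rfl fun k hk => ?_))
      have hk := Finset.ne_of_mem_erase hk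
      rw [h4 k hk]
      simp [hk, ρ, κ]
    · simp [κ, hM]
    · intro j k hj hk hjk
      simp [hj, hk, hB _ _ hjk]
    · intro j hj
      rw [h4 j hj]; exact hd j hj

open scoped PowerSeries in
lemma IsIsospectral.exists_eq_add_X_sq_mul {M : Matrix n n ℂ} (hM : ∀ i, M i i = 0) {w : n → ℂ}
    (hw : Function.Injective w) {σ : Equiv.Perm n} {y : n → ℂ⟦X⟧}
    (h : IsIsospectral M w PowerSeries.X 1 y)
    (hy : ∀ i, PowerSeries.constantCoeff (y i) = w (σ i)) (i : n) :
    ∃ e : ℂ⟦X⟧, y i = PowerSeries.C (w (σ i)) + PowerSeries.X ^ 2 * e ∧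
      PowerSeries.constantCoeff e = ∑ j, M (σ i) j * M j (σ i) / (w (σ i) - w j) -
        ∑ j, M i j * M j i / (w (σ i) - w (σ j)) := by
  obtain ⟨z, hz⟩ : PowerSeries.X ∣ PowerSeries.C (w (σ i)) - y i := by
    rw [PowerSeries.X_dvd_iff]
    simp [hy]
  have hdet := congrArg (Polynomial.eval (PowerSeries.C (w (σ i)))) h
  rw [eval_charpoly, eval_charpoly] at hdet
  have hne (j : n) (hj : j ≠ i) : w (σ i) - w (σ j) ≠ 0 :=
    sub_ne_zero.2 fun h => hj (σ.injective (hw h)).symm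
  obtain ⟨m₁, t₁, hdet₁, hm₁, ht₁⟩ := exists_det_eq_X_mul (M := M) (i := i) (z := z)
    (B := scalar n (PowerSeries.C (w (σ i))) - diagPerturb M PowerSeries.X y)
    (hM i) hne (by simp [diagPerturb, hM, hz])
    (fun j k hjk => by simp [diagPerturb, hjk])
    (fun j _ => by simp [diagPerturb, hM, hy])
  obtain ⟨m₂, t₂, hdet₂, hm₂, ht₂⟩ := exists_det_eq_X_mul (M := M) (i := σ i) (z := 0)
    (d := fun j => w (σ i) - w j)
    (B := scalar n (PowerSeries.C (w (σ i))) - diagPerturb M (PowerSeries.X : ℂ⟦X⟧)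
      fun i => 1 * algebraMap ℂ ℂ⟦X⟧ (w i))
    (hM _) (fun j hj => sub_ne_zero.2 fun h => hj (hw h).symm)
    (by simp [diagPerturb, hM])
    (fun j k hjk => by simp [diagPerturb, hjk])
    (fun j _ => by simp [diagPerturb, hM])
  have hu : ∏ k ∈ Finset.univ.erase i, (w (σ i) - w (σ k)) ≠ 0 :=
    Finset.prod_ne_zero_iff.2 fun k hk => hne k (Finset.ne_of_mem_erase hk)
  have hprod : ∏ k ∈ Finset.univ.erase (σ i), (w (σ i) - w k) =
      ∏ k ∈ Finset.univ.erase i, (w (σ i) - w (σ k)) :=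
    (Finset.prod_equiv σ (by simp) (by simp)).symm
  rw [hdet₁, hdet₂, zero_mul, zero_add] at hdet
  have heq := mul_left_cancel₀ PowerSeries.X_ne_zero hdet
  have hz0 : PowerSeries.constantCoeff z = 0 := by
    have := congrArg PowerSeries.constantCoeff heq
    simpa [hm₁, hu] using this
  obtain ⟨e, rfl⟩ := PowerSeries.X_dvd_iff.2 hz0
  have he : e * m₁ + t₁ = t₂ := by
    apply mul_left_cancel₀ (PowerSeries.X_ne_zero (R := ℂ))
    rw [← heq]; ring
  refine ⟨-e, by linear_combination -hz, ?_⟩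
  have := congrArg PowerSeries.constantCoeff he
  rw [map_add, map_mul, hm₁, ht₁, ht₂, hprod] at this
  rw [map_neg]
  apply mul_left_cancel₀ hu
  linear_combination -this

end Expansion

section PermSum

variable {n : Type*} [Fintype n] [DecidableEq n]

lemma Equiv.Perm.sum_eq_zero_of_mul_swap {f : Equiv.Perm n → ℂ} (b c : n)
    (h : ∀ σ, f (σ * Equiv.swap b c) = -f σ) : ∑ σ, f σ = 0 := by
  have := Equiv.sum_comp (Equiv.mulRight (Equiv.swap b c)) f
  simp only [Equiv.coe_mulRight, h, Finset.sum_neg_distrib] at this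
  exact self_eq_neg.1 this.symm

lemma Equiv.Perm.sum_div_sub_eq_zero (w : n → ℂ) (a : n) {b j : n} (hab : a ≠ b) (haj : a ≠ j) :
    ∑ σ : Equiv.Perm n, w (σ a) / (w (σ b) - w (σ j)) = 0 := by
  refine sum_eq_zero_of_mul_swap b j fun σ => ?_
  simp only [Equiv.Perm.mul_apply, Equiv.swap_apply_left, Equiv.swap_apply_right,
    Equiv.swap_apply_of_ne_of_ne hab haj]
  rw [← neg_sub, div_neg]

lemma sum_perm_eq_card_mul {w : n → ℂ} (hw : Function.Injective w) {m : n → n → ℂ}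
    (hm : ∀ i j, m i j = m j i) (G : n → ℂ) {δ : Equiv.Perm n → n → ℂ}
    (hδ : ∀ σ i, δ σ i = G (σ i) - ∑ j, m i j / (w (σ i) - w (σ j))) {a b c : n} (hab : a ≠ b)
    (hac : a ≠ c) (hbc : b ≠ c) :
    ∑ σ : Equiv.Perm n,
      (δ σ a * (w (σ b) - w (σ c)) + w (σ a) * (δ σ b - δ σ c)) =
    Fintype.card (Equiv.Perm n) * (m a b - m a c) := by
  have hne (σ : Equiv.Perm n) {i j : n} (hij : i ≠ j) : w (σ i) - w (σ j) ≠ 0 :=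
    sub_ne_zero.2 fun h => hij (σ.injective (hw h))
  have hG : ∑ σ : Equiv.Perm n,
      (G (σ a) * (w (σ b) - w (σ c)) + w (σ a) * (G (σ b) - G (σ c))) = 0 := by
    refine Equiv.Perm.sum_eq_zero_of_mul_swap b c fun σ => ?_
    simp only [Equiv.Perm.mul_apply, Equiv.swap_apply_left, Equiv.swap_apply_right,
      Equiv.swap_apply_of_ne_of_ne hab hac]
    ring
  have hT1 (j : n) (hjb : j ≠ b) (hjc : j ≠ c) :
      ∑ σ : Equiv.Perm n, m a j * ((w (σ b) - w (σ c)) / (w (σ a) - w (σ j))) = 0 := by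
    refine Equiv.Perm.sum_eq_zero_of_mul_swap b c fun σ => ?_
    simp only [Equiv.Perm.mul_apply, Equiv.swap_apply_left, Equiv.swap_apply_right,
      Equiv.swap_apply_of_ne_of_ne hab hac, Equiv.swap_apply_of_ne_of_ne hjb hjc]
    rw [← neg_sub, neg_div, mul_neg]
  have hT2 (i j : n) (hai : a ≠ i) (hja : j ≠ a) :
      ∑ σ : Equiv.Perm n, m i j * (w (σ a) / (w (σ i) - w (σ j))) = 0 := by
    rw [← Finset.mul_sum, Equiv.Perm.sum_div_sub_eq_zero w a hai hja.symm, mul_zero]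
  have h1 : ∑ j, ∑ σ : Equiv.Perm n, m a j * ((w (σ b) - w (σ c)) / (w (σ a) - w (σ j))) =
      (∑ σ : Equiv.Perm n, m a b * ((w (σ b) - w (σ c)) / (w (σ a) - w (σ b)))) +
      ∑ σ : Equiv.Perm n, m a c * ((w (σ b) - w (σ c)) / (w (σ a) - w (σ c))) := by
    rw [← Finset.sum_pair hbc (f := fun j => ∑ σ : Equiv.Perm n,
      m a j * ((w (σ b) - w (σ c)) / (w (σ a) - w (σ j))))]
    refine (Finset.sum_subset (Finset.subset_univ _) fun j _ hj => ?_).symm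
    simp only [Finset.mem_insert, Finset.mem_singleton, not_or] at hj
    exact hT1 j hj.1 hj.2
  have h2 (i : n) (hai : a ≠ i) :
      ∑ j, ∑ σ : Equiv.Perm n, m i j * (w (σ a) / (w (σ i) - w (σ j))) =
      ∑ σ : Equiv.Perm n, m a i * (w (σ a) / (w (σ i) - w (σ a))) := by
    rw [Finset.sum_eq_single a (fun j _ hj => hT2 i j hai hj) (by simp), hm i a]
  have h3 : ∑ σ : Equiv.Perm n,
      (δ σ a * (w (σ b) - w (σ c)) + w (σ a) * (δ σ b - δ σ c)) =
      ∑ σ : Equiv.Perm n, (G (σ a) * (w (σ b) - w (σ c)) + w (σ a) * (G (σ b) - G (σ c))) -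
      (∑ j, ∑ σ : Equiv.Perm n, m a j * ((w (σ b) - w (σ c)) / (w (σ a) - w (σ j))) +
      ∑ j, ∑ σ : Equiv.Perm n, m b j * (w (σ a) / (w (σ b) - w (σ j))) -
      ∑ j, ∑ σ : Equiv.Perm n, m c j * (w (σ a) / (w (σ c) - w (σ j)))) := by
    rw [Finset.sum_comm, Finset.sum_comm (s := Finset.univ (α := n)),
      Finset.sum_comm (s := Finset.univ (α := n)), ← Finset.sum_add_distrib,
      ← Finset.sum_sub_distrib, ← Finset.sum_sub_distrib]
    refine Finset.sum_congr rfl fun σ _ => ?_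
    have e1 (i : n) (t : ℂ) : ∑ j, m i j * (t / (w (σ i) - w (σ j))) =
        t * ∑ j, m i j / (w (σ i) - w (σ j)) := by
      rw [Finset.mul_sum]
      exact Finset.sum_congr rfl fun j _ => by ring
    rw [hδ, hδ, hδ, e1, e1, e1]
    ring
  rw [h3, hG, h1, h2 b hab, h2 c hac, ← Finset.sum_add_distrib, ← Finset.sum_add_distrib,
    ← Finset.sum_sub_distrib]
  have h4 (σ : Equiv.Perm n) : m a b * ((w (σ b) - w (σ c)) / (w (σ a) - w (σ b))) +
      m a c * ((w (σ b) - w (σ c)) / (w (σ a) - w (σ c))) +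
      m a b * (w (σ a) / (w (σ b) - w (σ a))) - m a c * (w (σ a) / (w (σ c) - w (σ a))) =
      -(m a b - m a c) - m a b * (w (σ c) / (w (σ a) - w (σ b))) +
        m a c * (w (σ b) / (w (σ a) - w (σ c))) := by
    have := hne σ hab
    have := hne σ hab.symm
    have := hne σ hac
    have := hne σ hac.symm
    field_simp
    ring
  rw [Finset.sum_congr rfl fun σ _ => h4 σ, Finset.sum_add_distrib, Finset.sum_sub_distrib,
    ← Finset.mul_sum, ← Finset.mul_sum, Equiv.Perm.sum_div_sub_eq_zero w c hac.symm hbc.symm,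
    Equiv.Perm.sum_div_sub_eq_zero w b hab.symm hbc]
  simp [mul_sub]

end PermSum

section Descent

open scoped PowerSeries

variable {n : Type*} [Fintype n] [DecidableEq n] {M : Matrix n n ℂ} {w : n → ℂ}
  {Ω : Type*} [Field Ω] [Algebra ℂ Ω]

lemma exists_algebraMap_eq_sum_of_isIsospectral [IsAlgClosed Ω] {R : Type*} [CommRing R]
    [IsDomain R] [CharZero R] [IsIntegrallyClosed R] [Algebra ℂ R] [Algebra R Ω]
    [IsScalarTower ℂ R Ω] [FaithfulSMul R Ω]
    (hM : ∀ d : n → ℂ, IsIsospectral M w 1 0 d → d = 0) {ι : Type*} [Fintype ι]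
    {x : ι → n → Ω} (hx : Function.Injective x) {r s : R}
    (hiff : ∀ y, IsIsospectral M w (algebraMap R Ω r) (algebraMap R Ω s) y ↔ ∃ σ, x σ = y)
    (a b c : n) : ∃ p, algebraMap R Ω p = ∑ σ, x σ a * (x σ b - x σ c) ∧
      ∀ φ : R →ₐ[ℂ] ℂ, φ r = 1 → φ s = 0 → φ p = 0 := by
  have : CharZero Ω := charZero_of_injective_algebraMap (algebraMap ℂ Ω).injective
  have hiso (σ : ι) := (hiff (x σ)).2 ⟨σ, rfl⟩
  let x' (σ : ι) (i : n) : integralClosure R Ω := ⟨x σ i, (hiso σ).isIntegral i⟩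
  have hiso' (σ : ι) : IsIsospectral M w (algebraMap R (integralClosure R Ω) r)
      (algebraMap R (integralClosure R Ω) s) (x' σ) :=
    IsIsospectral.of_map ((integralClosure R Ω).val.restrictScalars ℂ) Subtype.val_injective
      (hiso σ)
  let z : integralClosure R Ω := ∑ σ, x' σ a * (x' σ b - x' σ c)
  have hz : (z : Ω) = ∑ σ, x σ a * (x σ b - x σ c) := by
    simp [z, x']
  obtain ⟨p, hp⟩ := mem_range_algebraMap_of_forall_algHom z fun τ hτ => by
    have hiso (σ : ι) : IsIsospectral M w (algebraMap R Ω r) (algebraMap R Ω s)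
        fun i => τ (x' σ i) := by
      have := (hiso' σ).map (τ.restrictScalars ℂ)
      simpa only [AlgHom.restrictScalars_apply, AlgHom.commutes] using this
    choose f hf using fun σ => (hiff _).1 (hiso σ)
    have hinj : Function.Injective f := fun σ σ' h => hx <| funext fun i =>
      congrArg Subtype.val (hτ (congrFun ((hf σ).symm.trans ((congrArg x h).trans (hf σ'))) i))
    have hbij := Finite.injective_iff_bijective.1 hinj
    rw [hz, ← hbij.sum_comp]
    simp only [z, map_sum, map_mul, map_sub, hf]
  refine ⟨p, hp.trans hz, fun φ hr hs => ?_⟩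
  obtain ⟨π, hπ⟩ := exists_algHom_integralClosure (K := Ω) φ
  have h0 (σ : ι) : (fun i => π (x' σ i)) = 0 := by
    refine hM _ ?_
    have := (hiso' σ).map π
    rwa [hπ, hπ, hr, hs] at this
  have hpz : algebraMap R (integralClosure R Ω) p = z := Subtype.ext hp
  rw [← hπ, hpz]
  simp only [z, map_sum, map_mul]
  exact Finset.sum_eq_zero fun σ _ => by rw [show π (x' σ a) = 0 from congrFun (h0 σ) a, zero_mul]

lemma Polynomial.coeff_two_eq_zero_of_aeval_eq {s : Ω} (hs : Transcendental ℂ s)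
    {p q : Polynomial ℂ} (h : aeval s p = s ^ 2 * aeval s⁻¹ q) (hq : q.coeff 0 = 0) :
    p.coeff 2 = 0 := by
  have hs0 : s ≠ 0 := fun h0 => hs (h0 ▸ isAlgebraic_zero)
  let _ : Invertible s := invertibleOfNonzero hs0
  have h1 := eval₂_reflect_mul_pow (algebraMap ℂ Ω) s q.natDegree (reflect q.natDegree q)
    (natDegree_reflect_le.trans (max_self _).le)
  rw [reflect_reflect, invOf_eq_inv, ← aeval_def, ← aeval_def] at h1
  have h2 : p * X ^ q.natDegree = X ^ 2 * reflect q.natDegree q := by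
    apply (transcendental_iff_injective.1 hs)
    simp only [map_mul, map_pow, aeval_X, h, ← h1]
    ring
  have h3 := congrArg (coeff · (2 + q.natDegree)) h2
  simpa [coeff_mul_X_pow, coeff_X_pow_mul', coeff_reflect, hq] using h3

lemma PowerSeries.aeval_X_eq_coe (p : Polynomial ℂ) : Polynomial.aeval (X : ℂ⟦X⟧) p = p :=
  DFunLike.congr_fun (Polynomial.algHom_ext (f := Polynomial.aeval (X : ℂ⟦X⟧))
    (g := Polynomial.coeToPowerSeries.algHom ℂ) (by simp)) p

lemma PowerSeries.transcendental_algebraMap_X [Algebra ℂ⟦X⟧ Ω] [IsScalarTower ℂ ℂ⟦X⟧ Ω]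
    [FaithfulSMul ℂ⟦X⟧ Ω] : Transcendental ℂ (algebraMap ℂ⟦X⟧ Ω X) := by
  rw [transcendental_algebraMap_iff (FaithfulSMul.algebraMap_injective _ _),
    transcendental_iff_injective]
  intro p q h
  rw [aeval_X_eq_coe, aeval_X_eq_coe] at h
  exact Polynomial.coe_injective ℂ h

lemma exists_aeval_eq_sum_of_isIsospectral [IsAlgClosed Ω]
    (hM : ∀ d : n → ℂ, IsIsospectral M w 1 0 d → d = 0) {ι : Type*} [Fintype ι]
    {x : ι → n → Ω} (hx : Function.Injective x) {t : Ω} (ht : Transcendental ℂ t)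
    {r s : Polynomial ℂ} (hiff : ∀ y, IsIsospectral M w (Polynomial.aeval t r)
      (Polynomial.aeval t s) y ↔ ∃ σ, x σ = y) (a b c : n) :
    ∃ p, Polynomial.aeval t p = ∑ σ, x σ a * (x σ b - x σ c) ∧
      ∀ φ : Polynomial ℂ →ₐ[ℂ] ℂ, φ r = 1 → φ s = 0 → φ p = 0 := by
  let _ : Algebra (Polynomial ℂ) Ω := (Polynomial.aeval t).toRingHom.toAlgebra
  have _ : IsScalarTower ℂ (Polynomial ℂ) Ω :=
    IsScalarTower.of_algebraMap_eq fun c => (Polynomial.aeval_C t c).symm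
  have _ : FaithfulSMul (Polynomial ℂ) Ω :=
    (faithfulSMul_iff_algebraMap_injective _ _).2 (transcendental_iff_injective.1 ht)
  exact exists_algebraMap_eq_sum_of_isIsospectral hM hx hiff a b c

end Descent

section Existence

open scoped PowerSeries

variable {n : Type*} [Fintype n] [DecidableEq n]

lemma IsIsospectral.exists_perm_eq_algebraMap {M : Matrix n n ℂ} {w : n → ℂ}
    (hw : Function.Injective w) {Ω : Type*} [Field Ω] [Algebra ℂ Ω] [Algebra ℂ⟦X⟧ Ω]
    [IsScalarTower ℂ ℂ⟦X⟧ Ω] [FaithfulSMul ℂ⟦X⟧ Ω] {y : Equiv.Perm n → n → ℂ⟦X⟧}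
    (hy : ∀ σ, IsIsospectral M w PowerSeries.X 1 (y σ))
    (hy0 : ∀ σ i, PowerSeries.constantCoeff (y σ i) = w (σ i)) {z : n → Ω}
    (hz : IsIsospectral M w (algebraMap ℂ⟦X⟧ Ω PowerSeries.X) 1 z) :
    ∃ σ, (fun i => algebraMap ℂ⟦X⟧ Ω (y σ i)) = z := by
  let φ : ℂ⟦X⟧ →ₐ[ℂ] ℂ := { PowerSeries.constantCoeff with commutes' := fun c => by simp }
  have hφ : φ PowerSeries.X = 0 := PowerSeries.constantCoeff_X
  have : CharZero Ω := charZero_of_injective_algebraMap (algebraMap ℂ Ω).injective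
  let A := integralClosure ℂ⟦X⟧ Ω
  have hz1 : IsIsospectral M w (algebraMap ℂ⟦X⟧ Ω PowerSeries.X) (algebraMap ℂ⟦X⟧ Ω 1) z := by
    rwa [map_one]
  let z' (i : n) : A := ⟨z i, hz1.isIntegral i⟩
  have hz' : IsIsospectral M w (algebraMap ℂ⟦X⟧ A PowerSeries.X) 1 z' :=
    IsIsospectral.of_map (A.val.restrictScalars ℂ) Subtype.val_injective (by
      rwa [map_one])
  obtain ⟨π, hπ⟩ := exists_algHom_integralClosure (K := Ω) φ
  obtain ⟨σ, hσ⟩ := IsIsospectral.exists_perm (M := M) hw (y := fun i => π (z' i)) (by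
    have := hz'.map π
    rwa [hπ, hφ, map_one] at this)
  have hyA : IsIsospectral M w (algebraMap ℂ⟦X⟧ A PowerSeries.X) 1
      (fun i => algebraMap ℂ⟦X⟧ A (y σ i)) := by
    have := (hy σ).map (IsScalarTower.toAlgHom ℂ ℂ⟦X⟧ A)
    simpa only [IsScalarTower.coe_toAlgHom', map_one] using this
  have heq := IsIsospectral.eq_of_map_eq hw φ (π : A →+* ℂ) hπ hφ σ hyA hz'
    (fun i => (hπ _).trans (hy0 σ i)) hσ
  exact ⟨σ, funext fun i => congrArg Subtype.val (congrFun heq i)⟩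

lemma coeff_two_sum_eq_zero {M : Matrix n n ℂ} {w : n → ℂ} (hw : Function.Injective w)
    (hM : ∀ d : n → ℂ, IsIsospectral M w 1 0 d → d = 0) {y : Equiv.Perm n → n → ℂ⟦X⟧}
    (hy : ∀ σ, IsIsospectral M w PowerSeries.X 1 (y σ))
    (hy0 : ∀ σ i, PowerSeries.constantCoeff (y σ i) = w (σ i)) (a b c : n) :
    PowerSeries.coeff 2 (∑ σ, y σ a * (y σ b - y σ c)) = 0 := by
  let Ω := AlgebraicClosure (FractionRing ℂ⟦X⟧)
  have : CharZero Ω := charZero_of_injective_algebraMap (algebraMap ℂ Ω).injective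
  have : FaithfulSMul ℂ⟦X⟧ Ω := FaithfulSMul.trans ℂ⟦X⟧ (FractionRing ℂ⟦X⟧) Ω
  have hinj := FaithfulSMul.algebraMap_injective ℂ⟦X⟧ Ω
  let s : Ω := algebraMap ℂ⟦X⟧ Ω PowerSeries.X
  have hs : Transcendental ℂ s := PowerSeries.transcendental_algebraMap_X
  have hs0 : s ≠ 0 := fun h0 => hs (h0 ▸ isAlgebraic_zero)
  let x (σ : Equiv.Perm n) (i : n) : Ω := algebraMap ℂ⟦X⟧ Ω (y σ i)
  have hx : Function.Injective x := fun σ τ h => Equiv.ext fun i => hw <| by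
    rw [← hy0, ← hy0, hinj (congrFun h i)]
  have hiff (z : n → Ω) : IsIsospectral M w s 1 z ↔ ∃ σ, x σ = z := by
    refine ⟨IsIsospectral.exists_perm_eq_algebraMap hw hy hy0, ?_⟩
    rintro ⟨σ, rfl⟩
    have := (hy σ).map (IsScalarTower.toAlgHom ℂ ℂ⟦X⟧ Ω)
    simpa only [IsScalarTower.coe_toAlgHom', map_one] using this
  obtain ⟨p, hp, -⟩ := exists_aeval_eq_sum_of_isIsospectral hM hx hs (r := Polynomial.X) (s := 1)
    (fun z => by simpa using hiff z) a b c
  obtain ⟨q, hq, hq0⟩ := exists_aeval_eq_sum_of_isIsospectral hM (t := s⁻¹)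
    (x := fun σ i => s⁻¹ * x σ i) (r := 1) (s := Polynomial.X)
    (fun σ τ h => hx <| funext fun i => mul_left_cancel₀ (inv_ne_zero hs0) (congrFun h i))
    (fun h => hs (IsAlgebraic.inv_iff.1 h)) (fun z => by
      simp only [map_one, Polynomial.aeval_X]
      constructor
      · intro h
        have := h.smul s
        rw [mul_one, mul_inv_cancel₀ hs0] at this
        obtain ⟨σ, hσ⟩ := (hiff _).1 this
        exact ⟨σ, funext fun i => by rw [hσ, inv_mul_cancel_left₀ hs0]⟩
      · rintro ⟨σ, rfl⟩
        have := ((hiff _).2 ⟨σ, rfl⟩).smul s⁻¹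
        rwa [mul_one, inv_mul_cancel₀ hs0] at this) a b c
  have hqc : q.coeff 0 = 0 := by
    have := hq0 (Polynomial.aeval 0) (by simp) (by simp)
    rwa [Polynomial.coeff_zero_eq_aeval_zero]
  have hpq : Polynomial.aeval s p = s ^ 2 * Polynomial.aeval s⁻¹ q := by
    rw [hp, hq, Finset.mul_sum]
    refine Finset.sum_congr rfl fun σ _ => ?_
    have h1 : s * s⁻¹ = 1 := mul_inv_cancel₀ hs0
    linear_combination -(x σ a * (x σ b - x σ c) * (s * s⁻¹ + 1)) * h1
  have hp2 := Polynomial.coeff_two_eq_zero_of_aeval_eq hs hpq hqc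
  have hpy : (p : ℂ⟦X⟧) = ∑ σ, y σ a * (y σ b - y σ c) := by
    apply hinj
    rw [← PowerSeries.aeval_X_eq_coe, ← Polynomial.aeval_algebraMap_apply, hp]
    simp only [x, map_sum, map_mul, map_sub]
  rw [← hpy, Polynomial.coeff_coe, hp2]

theorem Matrix.exists_isospectral_diagonal {M : Matrix n n ℂ} (hM : ∀ i, M i i = 0) {a b c : n}
    (hab : a ≠ b) (hac : a ≠ c) (hbc : b ≠ c) (h : M a b * M b a ≠ M a c * M c a) :
    ∃ d : n → ℂ, d ≠ 0 ∧ (M + diagonal d).charpoly = M.charpoly := by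
  by_contra! hd
  let w (i : n) : ℂ := (Fintype.equivFin n i : ℕ)
  have hw : Function.Injective w := fun i j hij =>
    (Fintype.equivFin n).injective (Fin.ext (Nat.cast_injective hij))
  have hM' (d : n → ℂ) (hd' : IsIsospectral M w 1 0 d) : d = 0 := by
    by_contra h0
    refine hd d h0 ?_
    have : diagPerturb M 1 (fun i => 0 * algebraMap ℂ ℂ (w i)) = M := by
      ext i j
      simp [diagPerturb]
    rw [IsIsospectral, this] at hd'
    rw [← hd']
    congr 1
    ext i j
    simp [diagPerturb]
  choose y hy hy0 using exists_powerSeries_isIsospectral M hw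
  choose e he he0 using fun σ => (hy σ).exists_eq_add_X_sq_mul hM hw (hy0 σ)
  have h2 := coeff_two_sum_eq_zero hw hM' hy hy0 a b c
  have hterm (σ : Equiv.Perm n) : PowerSeries.coeff 2 (y σ a * (y σ b - y σ c)) =
      PowerSeries.constantCoeff (e σ a) * (w (σ b) - w (σ c)) +
        w (σ a) * (PowerSeries.constantCoeff (e σ b) - PowerSeries.constantCoeff (e σ c)) := by
    have : y σ a * (y σ b - y σ c) = PowerSeries.C (w (σ a) * (w (σ b) - w (σ c))) +
        PowerSeries.X ^ 2 * (e σ a * PowerSeries.C (w (σ b) - w (σ c)) +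
          PowerSeries.C (w (σ a)) * (e σ b - e σ c) +
          PowerSeries.X ^ 2 * (e σ a * (e σ b - e σ c))) := by
      rw [he, he, he]
      simp only [map_mul, map_sub]
      ring
    rw [this, map_add, PowerSeries.coeff_C, if_neg two_ne_zero, zero_add,
      PowerSeries.coeff_X_pow_mul', if_pos le_rfl, Nat.sub_self,
      PowerSeries.coeff_zero_eq_constantCoeff_apply]
    simp
  rw [map_sum, Finset.sum_congr rfl fun σ _ => hterm σ,
    sum_perm_eq_card_mul hw (m := fun i j => M i j * M j i) (fun i j => mul_comm _ _)
      (fun l => ∑ j, M l j * M j l / (w l - w j)) he0 hab hac hbc, mul_eq_zero] at h2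
  exact h2.elim (Nat.cast_ne_zero.2 Fintype.card_ne_zero) (sub_ne_zero.2 h)

end Existence

/-- Theorem 4.4: for `q ≥ 4`, the adjacency matrix `M` of the cycle graph `C_q`
admits a nonzero complex diagonal matrix `D` such that `M` and `M + D` have the
same characteristic polynomial. -/
theorem cycle_exists_isospectral_diagonal (q : ℕ) (hq : 4 ≤ q) :
    ∃ d : Fin q → ℂ, d ≠ 0 ∧
      (cycleAdjMatrix q + Matrix.diagonal d).charpoly = (cycleAdjMatrix q).charpoly := by
  have hlt (k : ℕ) (hk : k < 3) : k < q := by omega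
  have hmod (k : ℕ) (hk : k < 4) : (k = q ∧ k % q = 0) ∨ (k < q ∧ k % q = k) := by
    rcases (show k ≤ q by omega).eq_or_lt with h | h
    · exact Or.inl ⟨h, h ▸ Nat.mod_self k⟩
    · exact Or.inr ⟨h, Nat.mod_eq_of_lt h⟩
  refine Matrix.exists_isospectral_diagonal (a := ⟨0, hlt 0 (by norm_num)⟩)
    (b := ⟨1, hlt 1 (by norm_num)⟩) (c := ⟨2, hlt 2 (by norm_num)⟩) (fun i => ?_)
    (by simp) (by simp) (by simp) ?_
  · have hi : ((i : ℕ) + 1) % q ≠ i := by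
      rcases (show (i : ℕ) + 1 ≤ q from i.2).eq_or_lt with h | h
      · rw [h, Nat.mod_self]; omega
      · rw [Nat.mod_eq_of_lt h]; omega
    simp [cycleAdjMatrix, hi]
  · have h1 := hmod 1 (by norm_num)
    have h2 := hmod 2 (by norm_num)
    have h3 := hmod 3 (by norm_num)
    have e1 : 1 % q = 1 := by omega
    have e3 : 3 % q ≠ 0 := by omega
    simp [cycleAdjMatrix, e1, e3]
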